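/- (Lolli admits simple provability.) A Lolli sequent Γ;Δ ⊢ G has a uniform proof if and only if it has a simple proof. Here a uniform proof is a Lolli proof in which every sequent occurring in it whose goal formula is non-atomic is the conclusion of the right-introduction rule for the top-level logical symbol of that goal formula. A formula in the bounded context of a sequent in a proof is marked if it is the principal formula of an id instance, or it is B₁&B₂ in the conclusion of a &L instance whose premise has Bᵢ marked, or it is ∀x.B in the conclusion of a ∀L instance whose premise has B[t/x] marked, or it is G⊸P in the conclusion of a ⊸L instance whose right-hand premise has P marked, or it is G⇒P in the conclusion of a ⇒L instance whose right-hand premise has P marked. A simple proof is a uniform proof in which every left-introduction rule instance acts on a marked principal formula. -/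

import Mathlib

/- The language of Lolli.  `α` is the type of atomic formulas and `T` is the
type of first-order terms; quantification is represented in higher-order
abstract syntax over `T`, so that the substitution `B[t/x]` appearing in the
∀L and ∃R rules is function application, and the eigenvariable condition of
∀R is expressed by quantifying over all terms. -/
mutual

/-- Program clause formulas: `P ::= A | P & P | G ⊸ P | G ⇒ P | ∀x.P`. -/
inductive PF (α T : Type) : Type
  | atom : α → PF α T
  | conj : PF α T → PF α T → PF α T
  | limp : GF α T → PF α T → PF α T     -- `G ⊸ P`
  | imp  : GF α T → PF α T → PF α T     -- `G ⇒ P`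
  | all  : (T → PF α T) → PF α T

/-- Goal formulas:
`G ::= ⊤ | A | G & G | P ⊸ G | P ⇒ G | ∀x.G | ∃x.G | !G | G ⊗ G | G ⊕ G`. -/
inductive GF (α T : Type) : Type
  | top  : GF α T
  | atom : α → GF α T
  | conj : GF α T → GF α T → GF α T
  | limp : PF α T → GF α T → GF α T     -- `P ⊸ G`
  | imp  : PF α T → GF α T → GF α T     -- `P ⇒ G`
  | all  : (T → GF α T) → GF α T
  | ex   : (T → GF α T) → GF α T
  | bang : GF α T → GF α T
  | tensor : GF α T → GF α T → GF α T
  | oplus  : GF α T → GF α T → GF α T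

end

/-- Proof trees for Lolli sequents, represented as data so that properties of
the *shape* of a proof (uniformity, markedness, etc.) can be expressed.  Each
constructor is one inference rule of Lolli; principal formulas are explicit
arguments. -/
inductive Proof {α T : Type} : Set (PF α T) → Multiset (PF α T) → GF α T → Type
  | id (Γ : Set (PF α T)) (a : α) : Proof Γ {PF.atom a} (GF.atom a)
  | absorb {Γ Δ G} (B : PF α T) : B ∈ Γ → Proof Γ (B ::ₘ Δ) G → Proof Γ Δ G
  | topR (Γ : Set (PF α T)) (Δ : Multiset (PF α T)) : Proof Γ Δ GF.top
  | conjL₁ {Γ Δ G} (B₁ B₂ : PF α T) :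
      Proof Γ (B₁ ::ₘ Δ) G → Proof Γ (PF.conj B₁ B₂ ::ₘ Δ) G
  | conjL₂ {Γ Δ G} (B₁ B₂ : PF α T) :
      Proof Γ (B₂ ::ₘ Δ) G → Proof Γ (PF.conj B₁ B₂ ::ₘ Δ) G
  | conjR {Γ Δ} {G₁ G₂ : GF α T} :
      Proof Γ Δ G₁ → Proof Γ Δ G₂ → Proof Γ Δ (GF.conj G₁ G₂)
  | limpL {Γ Δ₁ Δ₂ G} (G₁ : GF α T) (B₂ : PF α T) :
      Proof Γ Δ₁ G₁ → Proof Γ (B₂ ::ₘ Δ₂) G →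
      Proof Γ (PF.limp G₁ B₂ ::ₘ (Δ₁ + Δ₂)) G
  | limpR {Γ Δ} {B : PF α T} {G : GF α T} :
      Proof Γ (B ::ₘ Δ) G → Proof Γ Δ (GF.limp B G)
  | impL {Γ Δ G} (G₁ : GF α T) (B₂ : PF α T) :
      Proof Γ 0 G₁ → Proof Γ (B₂ ::ₘ Δ) G → Proof Γ (PF.imp G₁ B₂ ::ₘ Δ) G
  | impR {Γ Δ} {B : PF α T} {G : GF α T} :
      Proof (insert B Γ) Δ G → Proof Γ Δ (GF.imp B G)
  | allL {Γ Δ G} (B : T → PF α T) (t : T) :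
      Proof Γ (B t ::ₘ Δ) G → Proof Γ (PF.all B ::ₘ Δ) G
  | allR {Γ Δ} {G : T → GF α T} :
      (∀ t : T, Proof Γ Δ (G t)) → Proof Γ Δ (GF.all G)
  | exR {Γ Δ} {G : T → GF α T} (t : T) : Proof Γ Δ (G t) → Proof Γ Δ (GF.ex G)
  | bangR {Γ} {G : GF α T} : Proof Γ 0 G → Proof Γ 0 (GF.bang G)
  | oplusR₁ {Γ Δ} {G₁ G₂ : GF α T} : Proof Γ Δ G₁ → Proof Γ Δ (GF.oplus G₁ G₂)
  | oplusR₂ {Γ Δ} {G₁ G₂ : GF α T} : Proof Γ Δ G₂ → Proof Γ Δ (GF.oplus G₁ G₂)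
  | tensorR {Γ Δ₁ Δ₂} {G₁ G₂ : GF α T} :
      Proof Γ Δ₁ G₁ → Proof Γ Δ₂ G₂ → Proof Γ (Δ₁ + Δ₂) (GF.tensor G₁ G₂)

/-- A goal formula is atomic if it is of the form `A`. -/
def AtomicGoal {α T : Type} : GF α T → Prop
  | GF.atom _ => True
  | _ => False

/-- A proof is uniform if every sequent occurring in it whose goal formula is
non-atomic is the conclusion of the right-introduction rule for the top-level
logical symbol of that goal formula.  Equivalently (since each sequent in a
proof tree is the conclusion of exactly one rule instance, and each
right-introduction rule introduces the top-level symbol of its conclusion's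
goal): the conclusion of every `id`, `absorb` and left-introduction rule
instance has an atomic goal, recursively throughout the proof. -/
def Uniform {α T : Type} : ∀ {Γ : Set (PF α T)} {Δ : Multiset (PF α T)}
    {G : GF α T}, Proof Γ Δ G → Prop
  | _, _, _, Proof.id _ _ => True
  | _, _, G, Proof.absorb _ _ p => AtomicGoal G ∧ Uniform p
  | _, _, _, Proof.topR _ _ => True
  | _, _, G, Proof.conjL₁ _ _ p => AtomicGoal G ∧ Uniform p
  | _, _, G, Proof.conjL₂ _ _ p => AtomicGoal G ∧ Uniform p
  | _, _, _, Proof.conjR p q => Uniform p ∧ Uniform q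
  | _, _, G, Proof.limpL _ _ p q => AtomicGoal G ∧ Uniform p ∧ Uniform q
  | _, _, _, Proof.limpR p => Uniform p
  | _, _, G, Proof.impL _ _ p q => AtomicGoal G ∧ Uniform p ∧ Uniform q
  | _, _, _, Proof.impR p => Uniform p
  | _, _, G, Proof.allL _ _ p => AtomicGoal G ∧ Uniform p
  | _, _, _, Proof.allR p => ∀ t, Uniform (p t)
  | _, _, _, Proof.exR _ p => Uniform p
  | _, _, _, Proof.bangR p => Uniform p
  | _, _, _, Proof.oplusR₁ p => Uniform p
  | _, _, _, Proof.oplusR₂ p => Uniform p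
  | _, _, _, Proof.tensorR p q => Uniform p ∧ Uniform q

/-- `MarkedRoot p F` says that the formula `F` is marked in the bounded
context of the conclusion sequent of the proof `p`, following the inductive
definition of marking: a formula is marked if it is the principal formula of
an `id` instance, or it is `B₁ & B₂` in the conclusion of a `&L` instance
whose premise has `Bᵢ` marked, or `∀x.B` in the conclusion of a `∀L` instance
whose premise has `B[t/x]` marked, or `G ⊸ P` (resp. `G ⇒ P`) in the
conclusion of a `⊸L` (resp. `⇒L`) instance whose right-hand premise has `P`
marked. -/
def MarkedRoot {α T : Type} : ∀ {Γ : Set (PF α T)} {Δ : Multiset (PF α T)}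
    {G : GF α T}, Proof Γ Δ G → PF α T → Prop
  | _, _, _, Proof.id _ a, F => F = PF.atom a
  | _, _, _, Proof.conjL₁ B₁ B₂ p, F => F = PF.conj B₁ B₂ ∧ MarkedRoot p B₁
  | _, _, _, Proof.conjL₂ B₁ B₂ p, F => F = PF.conj B₁ B₂ ∧ MarkedRoot p B₂
  | _, _, _, Proof.allL B t p, F => F = PF.all B ∧ MarkedRoot p (B t)
  | _, _, _, Proof.limpL G₁ B₂ _ q, F => F = PF.limp G₁ B₂ ∧ MarkedRoot q B₂
  | _, _, _, Proof.impL G₁ B₂ _ q, F => F = PF.imp G₁ B₂ ∧ MarkedRoot q B₂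
  | _, _, _, _, _ => False

/-- `Simple p` says that every left-introduction rule instance in `p` acts on
a marked principal formula (a simple proof is a *uniform* proof with this
property; uniformity is stated separately). -/
def Simple {α T : Type} : ∀ {Γ : Set (PF α T)} {Δ : Multiset (PF α T)}
    {G : GF α T}, Proof Γ Δ G → Prop
  | _, _, _, Proof.id _ _ => True
  | _, _, _, Proof.absorb _ _ p => Simple p
  | _, _, _, Proof.topR _ _ => True
  | _, _, _, Proof.conjL₁ B₁ B₂ p =>
      MarkedRoot (Proof.conjL₁ B₁ B₂ p) (PF.conj B₁ B₂) ∧ Simple p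
  | _, _, _, Proof.conjL₂ B₁ B₂ p =>
      MarkedRoot (Proof.conjL₂ B₁ B₂ p) (PF.conj B₁ B₂) ∧ Simple p
  | _, _, _, Proof.conjR p q => Simple p ∧ Simple q
  | _, _, _, Proof.limpL G₁ B₂ p q =>
      MarkedRoot (Proof.limpL G₁ B₂ p q) (PF.limp G₁ B₂) ∧ Simple p ∧ Simple q
  | _, _, _, Proof.limpR p => Simple p
  | _, _, _, Proof.impL G₁ B₂ p q =>
      MarkedRoot (Proof.impL G₁ B₂ p q) (PF.imp G₁ B₂) ∧ Simple p ∧ Simple q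
  | _, _, _, Proof.impR p => Simple p
  | _, _, _, Proof.allL B t p =>
      MarkedRoot (Proof.allL B t p) (PF.all B) ∧ Simple p
  | _, _, _, Proof.allR p => ∀ t, Simple (p t)
  | _, _, _, Proof.exR _ p => Simple p
  | _, _, _, Proof.bangR p => Simple p
  | _, _, _, Proof.oplusR₁ p => Simple p
  | _, _, _, Proof.oplusR₂ p => Simple p
  | _, _, _, Proof.tensorR p q => Simple p ∧ Simple q

theorem Multiset.add_eq_cons_iff {β : Type*} {s t u : Multiset β} {b : β} :
    s + t = b ::ₘ u ↔
      (∃ s', s = b ::ₘ s' ∧ u = s' + t) ∨ ∃ t', t = b ::ₘ t' ∧ u = s + t' := by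
  constructor
  · intro h
    have hb : b ∈ s + t := h ▸ Multiset.mem_cons_self b u
    rcases Multiset.mem_add.1 hb with hs | ht
    · obtain ⟨s', rfl⟩ := Multiset.exists_cons_of_mem hs
      rw [Multiset.cons_add, Multiset.cons_inj_right] at h
      exact .inl ⟨s', rfl, h.symm⟩
    · obtain ⟨t', rfl⟩ := Multiset.exists_cons_of_mem ht
      rw [Multiset.add_cons, Multiset.cons_inj_right] at h
      exact .inr ⟨t', rfl, h.symm⟩
  · rintro (⟨s', rfl, rfl⟩ | ⟨t', rfl, rfl⟩)
    · exact Multiset.cons_add ..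
    · exact Multiset.add_cons ..

/-- Provability in a focused presentation of Lolli.  The second index is an optional formula under
focus, kept outside the bounded context; left-introduction rules act only on that formula. -/
inductive FocusedProvable {α T : Type} :
    Set (PF α T) → Option (PF α T) → Multiset (PF α T) → GF α T → Prop
  | id {Γ} (a : α) : FocusedProvable Γ (some (PF.atom a)) 0 (GF.atom a)
  | conjL₁ {Γ Δ a} (B₁ B₂ : PF α T) : FocusedProvable Γ (some B₁) Δ (GF.atom a) →
      FocusedProvable Γ (some (PF.conj B₁ B₂)) Δ (GF.atom a)
  | conjL₂ {Γ Δ a} (B₁ B₂ : PF α T) : FocusedProvable Γ (some B₂) Δ (GF.atom a) →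
      FocusedProvable Γ (some (PF.conj B₁ B₂)) Δ (GF.atom a)
  | limpL {Γ Δ₁ Δ₂ a} (G : GF α T) (B : PF α T) : FocusedProvable Γ none Δ₁ G →
      FocusedProvable Γ (some B) Δ₂ (GF.atom a) →
      FocusedProvable Γ (some (PF.limp G B)) (Δ₁ + Δ₂) (GF.atom a)
  | impL {Γ Δ a} (G : GF α T) (B : PF α T) : FocusedProvable Γ none 0 G →
      FocusedProvable Γ (some B) Δ (GF.atom a) →
      FocusedProvable Γ (some (PF.imp G B)) Δ (GF.atom a)
  | allL {Γ Δ a} (B : T → PF α T) (t : T) : FocusedProvable Γ (some (B t)) Δ (GF.atom a) →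
      FocusedProvable Γ (some (PF.all B)) Δ (GF.atom a)
  | focus {Γ Δ a} (B : PF α T) : FocusedProvable Γ (some B) Δ (GF.atom a) →
      FocusedProvable Γ none (B ::ₘ Δ) (GF.atom a)
  | absorb {Γ Δ a} (B : PF α T) : B ∈ Γ → FocusedProvable Γ none (B ::ₘ Δ) (GF.atom a) →
      FocusedProvable Γ none Δ (GF.atom a)
  | topR {Γ Δ} : FocusedProvable Γ none Δ GF.top
  | conjR {Γ Δ G₁ G₂} : FocusedProvable Γ none Δ G₁ → FocusedProvable Γ none Δ G₂ →
      FocusedProvable Γ none Δ (GF.conj G₁ G₂)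
  | limpR {Γ Δ B G} : FocusedProvable Γ none (B ::ₘ Δ) G →
      FocusedProvable Γ none Δ (GF.limp B G)
  | impR {Γ Δ B G} : FocusedProvable (insert B Γ) none Δ G →
      FocusedProvable Γ none Δ (GF.imp B G)
  | allR {Γ Δ} {G : T → GF α T} : (∀ t, FocusedProvable Γ none Δ (G t)) →
      FocusedProvable Γ none Δ (GF.all G)
  | exR {Γ Δ} {G : T → GF α T} (t : T) : FocusedProvable Γ none Δ (G t) →
      FocusedProvable Γ none Δ (GF.ex G)
  | bangR {Γ G} : FocusedProvable Γ none 0 G → FocusedProvable Γ none 0 (GF.bang G)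
  | oplusR₁ {Γ Δ G₁ G₂} : FocusedProvable Γ none Δ G₁ →
      FocusedProvable Γ none Δ (GF.oplus G₁ G₂)
  | oplusR₂ {Γ Δ G₁ G₂} : FocusedProvable Γ none Δ G₂ →
      FocusedProvable Γ none Δ (GF.oplus G₁ G₂)
  | tensorR {Γ Δ₁ Δ₂ G₁ G₂} : FocusedProvable Γ none Δ₁ G₁ → FocusedProvable Γ none Δ₂ G₂ →
      FocusedProvable Γ none (Δ₁ + Δ₂) (GF.tensor G₁ G₂)

namespace FocusedProvable

variable {α T : Type}

/-- Weakening of the unbounded context. -/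
theorem mono {Γ Γ' : Set (PF α T)} {s : Option (PF α T)} {Δ : Multiset (PF α T)} {G : GF α T}
    (h : FocusedProvable Γ s Δ G) (hΓ : Γ ⊆ Γ') : FocusedProvable Γ' s Δ G := by
  induction h generalizing Γ' with
  | id a => exact .id a
  | conjL₁ B₁ B₂ _ ih => exact .conjL₁ _ _ (ih hΓ)
  | conjL₂ B₁ B₂ _ ih => exact .conjL₂ _ _ (ih hΓ)
  | limpL G B _ _ ih₁ ih₂ => exact .limpL _ _ (ih₁ hΓ) (ih₂ hΓ)
  | impL G B _ _ ih₁ ih₂ => exact .impL _ _ (ih₁ hΓ) (ih₂ hΓ)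
  | allL B t _ ih => exact .allL _ t (ih hΓ)
  | focus B _ ih => exact .focus _ (ih hΓ)
  | absorb B hB _ ih => exact .absorb B (hΓ hB) (ih hΓ)
  | topR => exact .topR
  | conjR _ _ ih₁ ih₂ => exact .conjR (ih₁ hΓ) (ih₂ hΓ)
  | limpR _ ih => exact .limpR (ih hΓ)
  | impR _ ih => exact .impR (ih (Set.insert_subset_insert hΓ))
  | allR _ ih => exact .allR fun t => ih t hΓ
  | exR t _ ih => exact .exR t (ih hΓ)
  | bangR _ ih => exact .bangR (ih hΓ)
  | oplusR₁ _ ih => exact .oplusR₁ (ih hΓ)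
  | oplusR₂ _ ih => exact .oplusR₂ (ih hΓ)
  | tensorR _ _ ih₁ ih₂ => exact .tensorR (ih₁ hΓ) (ih₂ hΓ)

/-- A bounded resource `B` may be replaced by resources `D` which can stand in for `B` wherever
`B` is put under focus. -/
theorem replace {Γ : Set (PF α T)} {s : Option (PF α T)} {Δ Δ₀ D : Multiset (PF α T)} {G : GF α T}
    {B : PF α T} (h : FocusedProvable Γ s Δ G) (hΔ : Δ = B ::ₘ Δ₀)
    (hD : ∀ Γ' Δ' a, Γ ⊆ Γ' → FocusedProvable Γ' (some B) Δ' (GF.atom a) →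
      FocusedProvable Γ' none (D + Δ') (GF.atom a)) :
    FocusedProvable Γ s (D + Δ₀) G := by
  induction h generalizing Δ₀ with
  | id a => exact absurd hΔ (Multiset.zero_ne_cons)
  | conjL₁ B₁ B₂ _ ih => exact .conjL₁ _ _ (ih hΔ hD)
  | conjL₂ B₁ B₂ _ ih => exact .conjL₂ _ _ (ih hΔ hD)
  | limpL G B h₁ h₂ ih₁ ih₂ =>
    rcases Multiset.add_eq_cons_iff.1 hΔ with ⟨Δ', e, rfl⟩ | ⟨Δ', e, rfl⟩
    · rw [← add_assoc]
      exact .limpL _ _ (ih₁ e hD) h₂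
    · rw [add_left_comm]
      exact .limpL _ _ h₁ (ih₂ e hD)
  | impL G B h₁ _ _ ih => exact .impL _ _ h₁ (ih hΔ hD)
  | allL B t _ ih => exact .allL _ t (ih hΔ hD)
  | focus C h ih =>
    rcases Multiset.cons_eq_cons.1 hΔ with ⟨rfl, rfl⟩ | ⟨_, Δ', e, rfl⟩
    · exact hD _ _ _ subset_rfl h
    · rw [Multiset.add_cons]
      exact .focus _ (ih e hD)
  | absorb C hC _ ih =>
    refine .absorb C hC ?_
    rw [← Multiset.add_cons]
    exact ih (by rw [hΔ, Multiset.cons_swap]) hD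
  | topR => exact .topR
  | conjR _ _ ih₁ ih₂ => exact .conjR (ih₁ hΔ hD) (ih₂ hΔ hD)
  | limpR _ ih =>
    refine .limpR ?_
    rw [← Multiset.add_cons]
    exact ih (by rw [hΔ, Multiset.cons_swap]) hD
  | impR _ ih =>
    exact .impR (ih hΔ fun Γ' Δ' a hΓ => hD Γ' Δ' a ((Set.subset_insert _ _).trans hΓ))
  | allR _ ih => exact .allR fun t => ih t hΔ hD
  | exR t _ ih => exact .exR t (ih hΔ hD)
  | bangR _ _ => exact absurd hΔ (Multiset.zero_ne_cons)
  | oplusR₁ _ ih => exact .oplusR₁ (ih hΔ hD)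
  | oplusR₂ _ ih => exact .oplusR₂ (ih hΔ hD)
  | tensorR h₁ h₂ ih₁ ih₂ =>
    rcases Multiset.add_eq_cons_iff.1 hΔ with ⟨Δ', e, rfl⟩ | ⟨Δ', e, rfl⟩
    · rw [← add_assoc]
      exact .tensorR (ih₁ e hD) h₂
    · rw [add_left_comm]
      exact .tensorR h₁ (ih₂ e hD)

theorem replace_singleton {Γ : Set (PF α T)} {Δ : Multiset (PF α T)} {G : GF α T} {B C : PF α T}
    (h : FocusedProvable Γ none (B ::ₘ Δ) G)
    (hC : ∀ Γ' Δ' a, Γ ⊆ Γ' → FocusedProvable Γ' (some B) Δ' (GF.atom a) →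
      FocusedProvable Γ' (some C) Δ' (GF.atom a)) :
    FocusedProvable Γ none (C ::ₘ Δ) G :=
  h.replace (D := {C}) rfl fun Γ' Δ' a hΓ hB => .focus C (hC Γ' Δ' a hΓ hB)

end FocusedProvable

theorem AtomicGoal.exists_eq_atom {α T : Type} {G : GF α T} (h : AtomicGoal G) :
    ∃ a, G = GF.atom a := by
  cases G <;> first | exact ⟨_, rfl⟩ | exact h.elim

theorem Uniform.focusedProvable {α T : Type} {Γ : Set (PF α T)} {Δ : Multiset (PF α T)}
    {G : GF α T} {p : Proof Γ Δ G} (hp : Uniform p) : FocusedProvable Γ none Δ G := by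
  induction p with
  | id Γ a => exact .focus _ (.id a)
  | absorb B hB p ih =>
    obtain ⟨a, rfl⟩ := hp.1.exists_eq_atom
    exact .absorb B hB (ih hp.2)
  | topR => exact .topR
  | conjL₁ B₁ B₂ p ih =>
    exact (ih hp.2).replace_singleton fun _ _ _ _ h => .conjL₁ _ _ h
  | conjL₂ B₁ B₂ p ih =>
    exact (ih hp.2).replace_singleton fun _ _ _ _ h => .conjL₂ _ _ h
  | conjR p q ihp ihq => exact .conjR (ihp hp.1) (ihq hp.2)
  | limpL G₁ B p q ihp ihq =>
    rw [← Multiset.cons_add]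
    refine (ihq hp.2.2).replace rfl fun Γ' Δ' a hΓ h => ?_
    rw [Multiset.cons_add]
    exact .focus _ (.limpL _ _ ((ihp hp.2.1).mono hΓ) h)
  | limpR p ih => exact .limpR (ih hp)
  | impL G₁ B p q ihp ihq =>
    exact (ihq hp.2.2).replace_singleton fun _ _ _ hΓ h =>
      .impL _ _ ((ihp hp.2.1).mono hΓ) h
  | impR p ih => exact .impR (ih hp)
  | allL B t p ih =>
    exact (ih hp.2).replace_singleton fun _ _ _ _ h => .allL _ t h
  | allR p ih => exact .allR fun t => ih t (hp t)
  | exR t p ih => exact .exR t (ih hp)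
  | bangR p ih => exact .bangR (ih hp)
  | oplusR₁ p ih => exact .oplusR₁ (ih hp)
  | oplusR₂ p ih => exact .oplusR₂ (ih hp)
  | tensorR p q ihp ihq => exact .tensorR (ihp hp.1) (ihq hp.2)

/-- The existence of a simple proof of a sequent, in which the focused formula, if any, is part of
the bounded context and is marked. -/
def SimplyProvable {α T : Type} (Γ : Set (PF α T)) :
    Option (PF α T) → Multiset (PF α T) → GF α T → Prop
  | none, Δ, G => ∃ p : Proof Γ Δ G, Uniform p ∧ Simple p
  | some B, Δ, G => ∃ p : Proof Γ (B ::ₘ Δ) G, Uniform p ∧ Simple p ∧ MarkedRoot p B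

theorem FocusedProvable.simplyProvable {α T : Type} {Γ : Set (PF α T)} {s : Option (PF α T)}
    {Δ : Multiset (PF α T)} {G : GF α T} (h : FocusedProvable Γ s Δ G) :
    SimplyProvable Γ s Δ G := by
  induction h with
  | id a => exact ⟨.id _ a, trivial, trivial, rfl⟩
  | conjL₁ B₁ B₂ _ ih =>
    obtain ⟨p, hu, hs, hm⟩ := ih
    exact ⟨.conjL₁ B₁ B₂ p, ⟨trivial, hu⟩, ⟨⟨rfl, hm⟩, hs⟩, rfl, hm⟩
  | conjL₂ B₁ B₂ _ ih =>
    obtain ⟨p, hu, hs, hm⟩ := ih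
    exact ⟨.conjL₂ B₁ B₂ p, ⟨trivial, hu⟩, ⟨⟨rfl, hm⟩, hs⟩, rfl, hm⟩
  | limpL G B _ _ ih₁ ih₂ =>
    obtain ⟨p, hpu, hps⟩ := ih₁
    obtain ⟨q, hqu, hqs, hm⟩ := ih₂
    exact ⟨.limpL G B p q, ⟨trivial, hpu, hqu⟩, ⟨⟨rfl, hm⟩, hps, hqs⟩, rfl, hm⟩
  | impL G B _ _ ih₁ ih₂ =>
    obtain ⟨p, hpu, hps⟩ := ih₁
    obtain ⟨q, hqu, hqs, hm⟩ := ih₂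
    exact ⟨.impL G B p q, ⟨trivial, hpu, hqu⟩, ⟨⟨rfl, hm⟩, hps, hqs⟩, rfl, hm⟩
  | allL B t _ ih =>
    obtain ⟨p, hu, hs, hm⟩ := ih
    exact ⟨.allL B t p, ⟨trivial, hu⟩, ⟨⟨rfl, hm⟩, hs⟩, rfl, hm⟩
  | focus B _ ih =>
    obtain ⟨p, hu, hs, -⟩ := ih
    exact ⟨p, hu, hs⟩
  | absorb B hB _ ih =>
    obtain ⟨p, hu, hs⟩ := ih
    exact ⟨.absorb B hB p, ⟨trivial, hu⟩, hs⟩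
  | topR => exact ⟨.topR _ _, trivial, trivial⟩
  | conjR _ _ ih₁ ih₂ =>
    obtain ⟨p, hpu, hps⟩ := ih₁
    obtain ⟨q, hqu, hqs⟩ := ih₂
    exact ⟨.conjR p q, ⟨hpu, hqu⟩, hps, hqs⟩
  | limpR _ ih =>
    obtain ⟨p, hu, hs⟩ := ih
    exact ⟨.limpR p, hu, hs⟩
  | impR _ ih =>
    obtain ⟨p, hu, hs⟩ := ih
    exact ⟨.impR p, hu, hs⟩
  | allR _ ih =>
    choose p hu hs using ih
    exact ⟨.allR p, hu, hs⟩
  | exR t _ ih =>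
    obtain ⟨p, hu, hs⟩ := ih
    exact ⟨.exR t p, hu, hs⟩
  | bangR _ ih =>
    obtain ⟨p, hu, hs⟩ := ih
    exact ⟨.bangR p, hu, hs⟩
  | oplusR₁ _ ih =>
    obtain ⟨p, hu, hs⟩ := ih
    exact ⟨.oplusR₁ p, hu, hs⟩
  | oplusR₂ _ ih =>
    obtain ⟨p, hu, hs⟩ := ih
    exact ⟨.oplusR₂ p, hu, hs⟩
  | tensorR _ _ ih₁ ih₂ =>
    obtain ⟨p, hpu, hps⟩ := ih₁
    obtain ⟨q, hqu, hqs⟩ := ih₂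
    exact ⟨.tensorR p q, ⟨hpu, hqu⟩, hps, hqs⟩

/-- **Lolli admits simple provability**: a Lolli sequent `Γ ; Δ ⊢ G` has a
uniform proof if and only if it has a simple proof (a uniform proof in which
every left-introduction rule instance acts on a marked principal formula). -/
theorem lolli_admits_simple_provability {α T : Type}
    (Γ : Set (PF α T)) (Δ : Multiset (PF α T)) (G : GF α T) :
    (∃ p : Proof Γ Δ G, Uniform p) ↔
      ∃ p : Proof Γ Δ G, Uniform p ∧ Simple p := by
  exact ⟨fun ⟨_, hp⟩ => hp.focusedProvable.simplyProvable, fun ⟨p, hp, _⟩ => ⟨p, hp⟩⟩
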